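/- (Sub-optimality inequality, second branch, deterministic form with explicit constants.) Suppose: (i) for every v ∈ ℝ^m, Ω(v) ∈ 𝓕 and Ω(v)(d_j) = v_j for all j; (ii) ε_m ≥ 0 satisfies |P_D(D(f)) − P(f)| ≤ ε_m for all f ∈ 𝓕; (iii) δ_m ≥ 0 satisfies |Ω_{x_i}(D(f)) − f(x_i)| ≤ δ_m for all f ∈ 𝓕 and all i; (iv) f̂ ∈ 𝓕 satisfies L(f̂) ≤ L(f) for all f ∈ 𝓕; (v) f̃ ∈ ℝ^m satisfies L_D(f̃) ≤ L_D(v) for all v ∈ ℝ^m; and (vi) there is a constant C ≥ 0 with ((1/n)∑_{i=1}^n (y_i − f̂(x_i))²)^{1/2} ≤ C. Then L(Ω(f̃)) ≤ L(f̂) + δ_m² + 2 C δ_m + 2 ε_m λ. -/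

import Mathlib

/-- The mean absolute value is at most the root mean square. -/
theorem mean_abs_le_sqrt_mean_sq {n : ℕ} (r : Fin n → ℝ) :
    (1 / n) * ∑ i, |r i| ≤ Real.sqrt ((1 / n) * ∑ i, r i ^ 2) := by
  apply Real.le_sqrt_of_sq_le
  rcases Nat.eq_zero_or_pos n with rfl | hn
  · simp
  have hn' : (0 : ℝ) < n := by exact_mod_cast hn
  have h : (∑ i, |r i|) ^ 2 ≤ n * ∑ i, r i ^ 2 := by
    simpa using sq_sum_le_card_mul_sum_sq (s := Finset.univ) (f := fun i => |r i|)
  calc ((1 / n) * ∑ i, |r i|) ^ 2 = (1 / n) ^ 2 * (∑ i, |r i|) ^ 2 := by ring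
    _ ≤ (1 / n) ^ 2 * (n * ∑ i, r i ^ 2) := by gcongr
    _ = (1 / n) * ∑ i, r i ^ 2 := by field_simp

/-- A uniform perturbation of size `δ` of the residuals raises the mean square by at most
`δ ^ 2 + 2 * C * δ`, where `C` bounds the root mean square. -/
theorem mean_sq_le_of_abs_sub_le {n : ℕ} (hn : 1 ≤ n) {r s : Fin n → ℝ} {δ C : ℝ} (hδ : 0 ≤ δ)
    (hrs : ∀ i, |s i - r i| ≤ δ) (hC : Real.sqrt ((1 / n) * ∑ i, r i ^ 2) ≤ C) :
    (1 / n) * ∑ i, s i ^ 2 ≤ (1 / n) * ∑ i, r i ^ 2 + δ ^ 2 + 2 * C * δ := by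
  have hn' : (0 : ℝ) < n := by exact_mod_cast hn
  have hpt : ∀ i, s i ^ 2 ≤ r i ^ 2 + 2 * δ * |r i| + δ ^ 2 := fun i => by
    have h : |s i| ≤ |r i| + δ := by
      linarith [abs_sub_abs_le_abs_sub (s i) (r i), hrs i]
    calc s i ^ 2 = |s i| ^ 2 := (sq_abs _).symm
      _ ≤ (|r i| + δ) ^ 2 := by gcongr
      _ = r i ^ 2 + 2 * δ * |r i| + δ ^ 2 := by rw [← sq_abs (r i)]; ring
  have hmean : (1 / n) * ∑ i, |r i| ≤ C := (mean_abs_le_sqrt_mean_sq r).trans hC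
  calc (1 / n) * ∑ i, s i ^ 2
      ≤ (1 / n) * ∑ i, (r i ^ 2 + 2 * δ * |r i| + δ ^ 2) := by
        gcongr with i; exact hpt i
    _ = (1 / n) * ∑ i, r i ^ 2 + δ ^ 2 + 2 * ((1 / n) * ∑ i, |r i|) * δ := by
        simp only [Finset.sum_add_distrib, ← Finset.mul_sum, Finset.sum_const, Finset.card_univ,
          Fintype.card_fin, nsmul_eq_mul]
        field_simp
        ring
    _ ≤ (1 / n) * ∑ i, r i ^ 2 + δ ^ 2 + 2 * C * δ := by gcongr


/-- Sub-optimality inequality, second branch, deterministic form: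
under the interpolation/penalty-approximation assumptions, if `f̂` minimizes `L` over `𝓕`,
`f̃` minimizes `L_D` over `ℝ^m`, and the empirical fit norm of `f̂` is at most `C`, then
`L (Ω f̃) ≤ L f̂ + δ_m² + 2 C δ_m + 2 ε_m λ`. -/
theorem mbs_suboptimality_second_branch {n m : ℕ} (hn : 1 ≤ n) (hm : 1 ≤ m)
    (a b : ℝ) (hab : a ≤ b)
    (x : Fin n → ℝ) (hx : ∀ i, x i ∈ Set.Icc a b)
    (y : Fin n → ℝ) (lam : ℝ) (hlam : 0 ≤ lam)
    (d : Fin m → ℝ) (hd : Monotone d)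
    (hda : d ⟨0, hm⟩ = a) (hdb : d ⟨m - 1, Nat.sub_lt hm one_pos⟩ = b)
    (𝓕 : Set (ℝ → ℝ)) (P : (ℝ → ℝ) → ℝ) (hP : ∀ f, 0 ≤ P f)
    (PD : (Fin m → ℝ) → ℝ) (Ω : (Fin m → ℝ) → (ℝ → ℝ))
    (L : (ℝ → ℝ) → ℝ)
    (hL : ∀ f : ℝ → ℝ, L f = (1 / n) * ∑ i, (y i - f (x i)) ^ 2 + lam * P f)
    (LD : (Fin m → ℝ) → ℝ)
    (hLD : ∀ v : Fin m → ℝ, LD v = (1 / n) * ∑ i, (y i - Ω v (x i)) ^ 2 + lam * PD v)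
    (hΩF : ∀ v : Fin m → ℝ, Ω v ∈ 𝓕)
    (hΩd : ∀ (v : Fin m → ℝ) (j : Fin m), Ω v (d j) = v j)
    (εm : ℝ) (hεm : 0 ≤ εm)
    (hPD : ∀ f ∈ 𝓕, |PD (fun j => f (d j)) - P f| ≤ εm)
    (δm : ℝ) (hδm : 0 ≤ δm)
    (hΩerr : ∀ f ∈ 𝓕, ∀ i : Fin n, |Ω (fun j => f (d j)) (x i) - f (x i)| ≤ δm)
    (fhat : ℝ → ℝ) (hfhat : fhat ∈ 𝓕) (hopt : ∀ f ∈ 𝓕, L fhat ≤ L f)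
    (ftilde : Fin m → ℝ) (hoptD : ∀ v : Fin m → ℝ, LD ftilde ≤ LD v)
    (C : ℝ) (hC : 0 ≤ C)
    (hfit : Real.sqrt ((1 / n) * ∑ i, (y i - fhat (x i)) ^ 2) ≤ C) :
    L (Ω ftilde) ≤ L fhat + δm ^ 2 + 2 * C * δm + 2 * εm * lam := by
  have hgrid : (fun j => Ω ftilde (d j)) = ftilde := funext (hΩd ftilde)
  have hPtilde := hPD _ (hΩF ftilde)
  rw [hgrid] at hPtilde
  have h₁ : lam * P (Ω ftilde) ≤ lam * (PD ftilde + εm) :=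
    mul_le_mul_of_nonneg_left (by linarith [(abs_le.mp hPtilde).1]) hlam
  have h₂ : lam * PD (fun j => fhat (d j)) ≤ lam * (P fhat + εm) :=
    mul_le_mul_of_nonneg_left (by linarith [(abs_le.mp (hPD _ hfhat)).2]) hlam
  have h₃ := hoptD fun j => fhat (d j)
  rw [hLD, hLD] at h₃
  have h₄ := mean_sq_le_of_abs_sub_le hn (s := fun i => y i - Ω (fun j => fhat (d j)) (x i))
    hδm (fun i => by
      rw [sub_sub_sub_cancel_left, abs_sub_comm]
      exact hΩerr _ hfhat i) hfit
  rw [hL, hL]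
  linarith
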